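/- Sphere automaton correctness: for the generalized 2NWA B_r and the map η sending a nonempty state E to its core sphere core(E), the following holds: for every nested word W over the 2-stack alphabet, every accepting run ρ of B_r on W, and every position i of W, η(ρ(i)) is isomorphic to the r-sphere Sph_r(W, i). In particular, for every r there exists a generalized 2NWA that accepts all nested words and, in every accepting run, correctly computes the isomorphism type of the r-sphere around every position. -/

import Mathlib

/-- The *kind* of a letter in a `K`-stack call-return alphabet: a call of some
stack `s`, a return of some stack `s`, or an internal action. -/
inductive CRKind (K : ℕ) where
  | call (s : Fin K)
  | ret (s : Fin K)
  | int

/-- A `K`-stack call-return alphabet over the letters `A`: every letter is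
(exclusively) a call of one stack, a return of one stack, or internal.  This
encodes the pairwise disjointness of the collection
`⟨{(Σ_c^s, Σ_r^s)}_{s∈[K]}, Σ_int⟩` together with `Σ` being their union. -/
structure CRAlphabet (K : ℕ) (A : Type) where
  kind : A → CRKind K

namespace CRAlphabet

variable {K : ℕ} {A : Type}

def callSet (h : CRAlphabet K A) (s : Fin K) : Set A := {a | h.kind a = .call s}
def retSet (h : CRAlphabet K A) (s : Fin K) : Set A := {a | h.kind a = .ret s}
def intSet (h : CRAlphabet K A) : Set A := {a | h.kind a = .int}

end CRAlphabet

/-- `s`-well-formed strings: generated by the grammar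
`A ::= aAb | AA | ε | c` with `a ∈ c`, `b ∈ r`, `c ∉ c ∪ r`. -/
inductive SWellFormed {A : Type} (c r : Set A) : List A → Prop where
  | nil : SWellFormed c r []
  | single {x : A} : x ∉ c → x ∉ r → SWellFormed c r [x]
  | wrap {a b : A} {u : List A} : a ∈ c → b ∈ r → SWellFormed c r u →
      SWellFormed c r (a :: u ++ [b])
  | concat {u v : List A} : SWellFormed c r u → SWellFormed c r v →
      SWellFormed c r (u ++ v)

/-- The matching relation `μ^s` of the nested word determined by the string
`w` (positions `0`-based): `(i,j) ∈ μ^s` iff `i < j`, `λ(i) ∈ Σ_c^s`,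
`λ(j) ∈ Σ_r^s` and `λ(i+1) … λ(j-1)` is `s`-well formed. -/
def Matched {K : ℕ} {A : Type} (h : CRAlphabet K A) (w : List A) (s : Fin K)
    (i j : ℕ) : Prop :=
  i < j ∧ j < w.length ∧
  (∃ a, w[i]? = some a ∧ a ∈ h.callSet s) ∧
  (∃ b, w[j]? = some b ∧ b ∈ h.retSet s) ∧
  SWellFormed (h.callSet s) (h.retSet s) ((w.take j).drop (i + 1))

/-- The full matching relation `μ = ⋃_s μ^s`. -/
def MuAny {K : ℕ} {A : Type} (h : CRAlphabet K A) (w : List A) (i j : ℕ) : Prop :=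
  ∃ s, Matched h w s i j

/-- Gaifman adjacency of positions of the nested word of `w`:
`i ↔ j` iff `(i,j)` or `(j,i)` is in `⋖ ∪ μ`. -/
def Adj {K : ℕ} {A : Type} (h : CRAlphabet K A) (w : List A) (i j : ℕ) : Prop :=
  (j = i + 1 ∧ j < w.length) ∨ (i = j + 1 ∧ i < w.length) ∨
    MuAny h w i j ∨ MuAny h w j i

/-- `DistLE h w d i j`: the Gaifman distance between `i` and `j` in the
nested word of `w` is at most `d`. -/
def DistLE {K : ℕ} {A : Type} (h : CRAlphabet K A) (w : List A) :
    ℕ → ℕ → ℕ → Prop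
  | 0, i, j => i = j
  | d + 1, i, j => i = j ∨ ∃ k, Adj h w i k ∧ DistLE h w d k j

/-- The ball of radius `r` around position `i` (the universe of the
`r`-sphere `Sph_r(w,i)`). -/
def ball {K : ℕ} {A : Type} (h : CRAlphabet K A) (w : List A) (r i : ℕ) : Set ℕ :=
  {j | DistLE h w r i j}

/-- `f` is an isomorphism from the `r`-sphere of `v` around `c` onto the
`r`-sphere of `w` around `i` (mapping center to center and preserving labels,
successor edges and matching edges). -/
def SphIsoF {K : ℕ} {A : Type} (h : CRAlphabet K A) (r : ℕ) (v : List A) (c : ℕ)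
    (w : List A) (i : ℕ) (f : ℕ → ℕ) : Prop :=
  c < v.length ∧ i < w.length ∧ f c = i ∧
  Set.BijOn f (ball h v r c) (ball h w r i) ∧
  (∀ j ∈ ball h v r c, v[j]? = w[(f j)]?) ∧
  (∀ j ∈ ball h v r c, ∀ k ∈ ball h v r c,
    ((k = j + 1 ∧ k < v.length) ↔ (f k = f j + 1 ∧ f k < w.length)) ∧
    (∀ s, Matched h v s j k ↔ Matched h w s (f j) (f k)))

/-- The `r`-sphere of `v` around `c` is isomorphic to the `r`-sphere of `w`
around `i`. -/
def SphIso {K : ℕ} {A : Type} (h : CRAlphabet K A) (r : ℕ) (v : List A) (c : ℕ)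
    (w : List A) (i : ℕ) : Prop :=
  ∃ f, SphIsoF h r v c w i f

/-- A generalized multi-stack nested-word automaton (generalized MNWA) over a
`K`-stack call-return alphabet: `delta1` contains local/push/unmatched-return
transitions, `delta2` the transitions at matched returns (consulting also the
state reached at the matching call); `qC` is the set of calling states.  An
MNWA is a generalized MNWA with `qC = ∅`. -/
structure GMNWA (K : ℕ) (A : Type) (Q : Type) where
  delta1 : Q → A → Q → Prop
  delta2 : Q → Q → A → Q → Prop
  qI : Set Q
  qF : Set Q
  qC : Set Q

/-- `ρ` is a run of the generalized MNWA `B` on the (nonempty) nested word of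
`w` (positions `0`-based). -/
def gRun {K : ℕ} {A Q : Type} (h : CRAlphabet K A) (B : GMNWA K A Q)
    (w : List A) (ρ : ℕ → Q) : Prop :=
  (∃ q ∈ B.qI, ∃ a, w[0]? = some a ∧ B.delta1 q a (ρ 0)) ∧
  ∀ i, 0 < i → i < w.length → ∃ a, w[i]? = some a ∧
    ((∃ j, MuAny h w j i ∧ B.delta2 (ρ j) (ρ (i - 1)) a (ρ i)) ∨
     ((¬ ∃ j, MuAny h w j i) ∧ B.delta1 (ρ (i - 1)) a (ρ i)))

/-- The run `ρ` of `B` on `w` is accepting: it ends in a final state, and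
every position carrying a calling state is a call with a matching return. -/
def gAcc {K : ℕ} {A Q : Type} (h : CRAlphabet K A) (B : GMNWA K A Q)
    (w : List A) (ρ : ℕ → Q) : Prop :=
  ρ (w.length - 1) ∈ B.qF ∧ ∀ i < w.length, ρ i ∈ B.qC → ∃ j, MuAny h w i j

/-- The language of the generalized MNWA `B` (as a set of nonempty strings,
identified with their nested words via the canonical bijection). -/
def gLang {K : ℕ} {A Q : Type} (h : CRAlphabet K A) (B : GMNWA K A Q) :
    Set (List A) :=
  {w | w ≠ [] ∧ ∃ ρ, gRun h B w ρ ∧ gAcc h B w ρ}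

/-- The signed half-turn, around the point `p`, of a moving point that runs from `a` to `b` along
an arc on the side `σ` of the line (`σ = 0` for a step along the line). -/
def halfTurn (σ : ℤ) (a b p : ℕ) : ℤ :=
  σ * ((if a < p then 1 else 0) - (if b < p then 1 else 0))

/-- The pairs of half-turns of two disjoint non-crossing edges agree. -/
theorem halfTurn_exchange {σ σ' : ℤ} {a b a' b' : ℕ}
    (h1 : a ≠ a') (h2 : a ≠ b') (h3 : b ≠ a') (h4 : b ≠ b')
    (hσ : σ = -1 ∨ σ = 0 ∨ σ = 1) (hσ' : σ' = -1 ∨ σ' = 0 ∨ σ' = 1)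
    (hl : σ = 0 → b = a + 1 ∨ a = b + 1) (hl' : σ' = 0 → b' = a' + 1 ∨ a' = b' + 1)
    (hc : σ = σ' → σ ≠ 0 →
      ¬ (min a b < min a' b' ∧ min a' b' < max a b ∧ max a b < max a' b') ∧
      ¬ (min a' b' < min a b ∧ min a b < max a' b' ∧ max a' b' < max a b)) :
    halfTurn σ a b a' - halfTurn σ a b b' = halfTurn σ' a' b' a - halfTurn σ' a' b' b := by
  have flip : ∀ p q : ℕ, p ≠ q → (if q < p then (1 : ℤ) else 0) = 1 - if p < q then 1 else 0 := by
    intro p q hpq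
    split_ifs <;> omega
  unfold halfTurn
  rw [flip a a' h1, flip b a' h3, flip a b' h2, flip b b' h4]
  suffices h : σ = -σ' ∨ ((if a < a' then (1 : ℤ) else 0) - (if b < a' then 1 else 0)) =
      (if a < b' then 1 else 0) - (if b < b' then 1 else 0) by
    rcases h with rfl | h
    · ring
    · linear_combination (σ + σ') * h
  have hcase : σ = -σ' ∨ σ = 0 ∨ σ' = 0 ∨ (σ = σ' ∧ σ ≠ 0) := by omega
  rcases hcase with h | h | h | ⟨h, h'⟩
  · exact Or.inl h
  · have := hl h
    clear hc hl hl' hσ hσ' flip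
    right
    split_ifs <;> omega
  · have := hl' h
    clear hc hl hl' hσ hσ' flip
    right
    split_ifs <;> omega
  · obtain ⟨c1, c2⟩ := hc h h'
    clear hc hl hl' hσ hσ' h h' flip
    right
    rcases le_total a b with e | e <;> rcases le_total a' b' with e' | e' <;>
      simp only [e, e', min_eq_left, min_eq_right, max_eq_left, max_eq_right] at c1 c2 <;>
      split_ifs <;> omega

/-- The turning of a closed polygonal curve at the vertex `s + 1`. -/
def turning (x : ℕ → ℕ) (σ : ℕ → ℤ) (s : ℕ) : ℤ :=
  halfTurn (σ (s + 1)) (x (s + 1)) (x (s + 2)) (x s) + halfTurn (σ s) (x s) (x (s + 1)) (x (s + 2))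

/-- A simple closed curve of length `N`, made of steps along a line and of arcs on both sides of
the line, without crossings.  Arcs are never consecutive. -/
structure SimpleCurve (x : ℕ → ℕ) (σ : ℕ → ℤ) (N : ℕ) : Prop where
  three_le : 3 ≤ N
  period : ∀ k, x (k + N) = x k
  sidePeriod : ∀ k, σ (k + N) = σ k
  inj : ∀ a b, x a = x b → a % N = b % N
  side : ∀ k, σ k = -1 ∨ σ k = 0 ∨ σ k = 1
  line : ∀ k, σ k = 0 → x (k + 1) = x k + 1 ∨ x k = x (k + 1) + 1
  alternate : ∀ k, σ k = 0 ∨ σ (k + 1) = 0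
  noncrossing : ∀ s t, σ s = σ t → σ s ≠ 0 →
    ¬ (min (x s) (x (s + 1)) < min (x t) (x (t + 1)) ∧
      min (x t) (x (t + 1)) < max (x s) (x (s + 1)) ∧
      max (x s) (x (s + 1)) < max (x t) (x (t + 1)))

namespace SimpleCurve

variable {x : ℕ → ℕ} {σ : ℕ → ℤ} {N : ℕ}

theorem ne_of_lt (hC : SimpleCurve x σ N) {a b : ℕ} (hab : a < b) (hb : b < a + N) :
    x a ≠ x b := by
  intro he
  have h1 := hC.inj a b he
  have h2 : N ∣ b - a := (Nat.modEq_iff_dvd' hab.le).1 h1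
  have := Nat.le_of_dvd (by omega) h2
  omega

theorem shift (hC : SimpleCurve x σ N) (c : ℕ) :
    SimpleCurve (fun k => x (c + k)) (fun k => σ (c + k)) N where
  three_le := hC.three_le
  period k := by simpa only [add_assoc] using hC.period (c + k)
  sidePeriod k := by simpa only [add_assoc] using hC.sidePeriod (c + k)
  inj a b he := Nat.ModEq.add_left_cancel' c (hC.inj _ _ he)
  side k := hC.side _
  line k := hC.line (c + k)
  alternate k := hC.alternate (c + k)
  noncrossing s t := hC.noncrossing (c + s) (c + t)

theorem exchange (hC : SimpleCurve x σ N) {s t : ℕ} (hst : s + 1 < t) (ht : t + 1 < s + N) :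
    halfTurn (σ s) (x s) (x (s + 1)) (x t) - halfTurn (σ s) (x s) (x (s + 1)) (x (t + 1)) =
      halfTurn (σ t) (x t) (x (t + 1)) (x s) -
        halfTurn (σ t) (x t) (x (t + 1)) (x (s + 1)) :=
  halfTurn_exchange (hC.ne_of_lt (by omega) (by omega)) (hC.ne_of_lt (by omega) (by omega))
    (hC.ne_of_lt (by omega) (by omega)) (hC.ne_of_lt (by omega) (by omega))
    (hC.side _) (hC.side _) (hC.line _) (hC.line _)
    fun h1 h2 => ⟨hC.noncrossing s t h1 h2, hC.noncrossing t s h1.symm (h1 ▸ h2)⟩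

/-- The turning at a vertex is determined by the directions of the two edges. -/
theorem turning_eq (hC : SimpleCurve x σ N) (s : ℕ) :
    turning x σ s = (σ (s + 1) - σ s) *
      ((if x (s + 1) < x s then 1 else 0) - (if x (s + 2) < x (s + 1) then 1 else 0)) := by
  have h3 := hC.three_le
  have n1 := hC.ne_of_lt (a := s) (b := s + 1) (by omega) (by omega)
  have n2 := hC.ne_of_lt (a := s) (b := s + 2) (by omega) (by omega)
  have n3 := hC.ne_of_lt (a := s + 1) (b := s + 2) (by omega) (by omega)
  have l1 := hC.line s
  have l2 := hC.line (s + 1)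
  rw [show s + 1 + 1 = s + 2 from rfl] at l2
  unfold turning halfTurn
  rcases hC.alternate s with h0 | h0
  · rw [h0]
    have := l1 h0
    rcases hC.side (s + 1) with h | h | h <;> rw [h] <;> split_ifs <;> omega
  · rw [h0]
    have := l2 h0
    rcases hC.side s with h | h | h <;> rw [h] <;> split_ifs <;> omega

theorem turning_parity (hC : SimpleCurve x σ N) (s : ℕ) :
    ∃ z : ℤ, turning x σ s =
      (if x (s + 1) < x s then 1 else 0) - (if x (s + 2) < x (s + 1) then 1 else 0) + 2 * z := by
  have h3 := hC.three_le
  have n2 := hC.ne_of_lt (a := s) (b := s + 2) (by omega) (by omega)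
  have l1 := hC.line s
  have l2 := hC.line (s + 1)
  rw [show s + 1 + 1 = s + 2 from rfl] at l2
  rw [hC.turning_eq]
  suffices h : ∀ e : ℤ, (σ (s + 1) - σ s) * e = e + 2 * 0 ∨
      (σ (s + 1) - σ s) * e = e + 2 * (-e) ∨ (σ (s + 1) = 0 ∧ σ s = 0) by
    rcases h ((if x (s + 1) < x s then 1 else 0) - (if x (s + 2) < x (s + 1) then 1 else 0))
      with h | h | ⟨h, h'⟩
    · exact ⟨_, h⟩
    · exact ⟨_, h⟩
    · refine ⟨0, ?_⟩
      have := l1 h'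
      have := l2 h
      rw [h, h']
      split_ifs <;> omega
  intro e
  rcases hC.alternate s with h0 | h0 <;> rw [h0]
  · rcases hC.side (s + 1) with h | h | h <;> rw [h] <;> simp; omega
  · rcases hC.side s with h | h | h <;> rw [h] <;> simp; omega

theorem sum_turning_eq (hC : SimpleCurve x σ N) (k : ℕ) (hk : k + 2 ≤ N) :
    ∑ s ∈ Finset.range k, turning x σ s =
      ∑ t ∈ Finset.range k, halfTurn (σ (t + 1)) (x (t + 1)) (x (t + 2)) (x 0) +
      ∑ s ∈ Finset.range k, halfTurn (σ s) (x s) (x (s + 1)) (x (k + 1)) := by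
  induction k with
  | zero => simp
  | succ k ih =>
    have h1 : ∑ s ∈ Finset.range k,
        (halfTurn (σ s) (x s) (x (s + 1)) (x (k + 1)) -
          halfTurn (σ s) (x s) (x (s + 1)) (x (k + 2))) =
        halfTurn (σ (k + 1)) (x (k + 1)) (x (k + 2)) (x 0) -
          halfTurn (σ (k + 1)) (x (k + 1)) (x (k + 2)) (x k) := by
      rw [← Finset.sum_range_sub' (fun s => halfTurn (σ (k + 1)) (x (k + 1)) (x (k + 2)) (x s))]
      refine Finset.sum_congr rfl fun s hs => ?_
      rw [Finset.mem_range] at hs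
      exact hC.exchange (by omega) (by omega)
    rw [Finset.sum_sub_distrib] at h1
    rw [Finset.sum_range_succ, ih (by omega), Finset.sum_range_succ, Finset.sum_range_succ]
    unfold turning
    linarith

/-- The discrete theorem of turning tangents, for curves starting at their leftmost vertex. -/
theorem sum_turning_of_min (hC : SimpleCurve x σ N) (hmin : ∀ k, x 0 ≤ x k) :
    ∑ s ∈ Finset.range N, turning x σ s = 2 ∨ ∑ s ∈ Finset.range N, turning x σ s = -2 := by
  obtain ⟨M, rfl⟩ : ∃ M, N = M + 3 := ⟨N - 3, by have := hC.three_le; omega⟩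
  have hN : x (M + 3) = x 0 := by simpa using hC.period 0
  have hN1 : x (M + 4) = x 1 := by have := hC.period 1; rwa [show 1 + (M + 3) = M + 4 by ring] at this
  have hs0 : σ (M + 3) = σ 0 := by simpa using hC.sidePeriod 0
  have hz : ∀ (e : ℤ) (a b : ℕ), halfTurn e (x a) (x b) (x 0) = 0 := by
    intro e a b
    simp [halfTurn, not_lt.2 (hmin a), not_lt.2 (hmin b)]
  have key := hC.sum_turning_eq (M + 1) (by omega)
  simp only [hz, Finset.sum_const_zero, zero_add] at key
  rw [Finset.sum_range_succ' (fun s => halfTurn (σ s) (x s) (x (s + 1)) (x (M + 1 + 1)))] at key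
  have h1 : ∑ s ∈ Finset.range M,
      (halfTurn (σ (s + 1)) (x (s + 1)) (x (s + 2)) (x (M + 2)) -
        halfTurn (σ (s + 1)) (x (s + 1)) (x (s + 2)) (x (M + 3))) =
      halfTurn (σ (M + 2)) (x (M + 2)) (x (M + 3)) (x 1) -
        halfTurn (σ (M + 2)) (x (M + 2)) (x (M + 3)) (x (M + 1)) := by
    rw [← Finset.sum_range_sub'
      (fun s => halfTurn (σ (M + 2)) (x (M + 2)) (x (M + 3)) (x (s + 1)))]
    refine Finset.sum_congr rfl fun s hs => ?_
    rw [Finset.mem_range] at hs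
    exact hC.exchange (by omega) (by omega)
  rw [Finset.sum_sub_distrib] at h1
  simp only [hN, hz, Finset.sum_const_zero, sub_zero] at h1
  have hlast := hC.turning_eq (M + 2)
  have hτ : turning x σ (M + 2) = 1 ∨ turning x σ (M + 2) = -1 := by
    rw [hlast, show M + 2 + 1 = M + 3 from rfl, show M + 2 + 2 = M + 4 from rfl, hN, hN1, hs0]
    have n1 := hC.ne_of_lt (a := 0) (b := 1) (by omega) (by omega)
    have n2 := hC.ne_of_lt (a := 0) (b := M + 2) (by omega) (by omega)
    have n3 := hC.ne_of_lt (a := 1) (b := M + 2) (by omega) (by omega)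
    have m1 := hmin 1
    have m2 := hmin (M + 2)
    have l1 := hC.line 0
    have l2 := hC.line (M + 2)
    have al := hC.alternate (M + 2)
    rw [show M + 2 + 1 = M + 3 from rfl, hs0] at al
    rw [show M + 2 + 1 = M + 3 from rfl, hN] at l2
    rw [if_pos (by omega), if_neg (by omega)]
    rw [zero_add] at l1
    have s0 := hC.side 0
    have s2 := hC.side (M + 2)
    simp only [sub_zero, mul_one]
    omega
  have hsum : ∑ s ∈ Finset.range (M + 3), turning x σ s = 2 * turning x σ (M + 2) := by
    rw [Finset.sum_range_succ, Finset.sum_range_succ, key]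
    have e1 : turning x σ (M + 1) = halfTurn (σ (M + 2)) (x (M + 2)) (x 0) (x (M + 1)) := by
      unfold turning
      rw [show M + 1 + 2 = M + 3 from rfl, hN, hz]; simp
    have e2 : turning x σ (M + 2) = halfTurn (σ 0) (x 0) (x 1) (x (M + 2)) +
        halfTurn (σ (M + 2)) (x (M + 2)) (x 0) (x 1) := by
      unfold turning
      rw [show M + 2 + 1 = M + 3 from rfl, show M + 2 + 2 = M + 4 from rfl, hN, hN1, hs0]
    rw [e1]
    simp only [Nat.zero_add, show ∀ a, a + 1 + 1 = a + 2 from fun _ => rfl] at *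
    linarith
  rcases hτ with h | h <;> rw [h] at hsum
  · exact Or.inl hsum
  · exact Or.inr hsum

/-- A simple closed curve cannot wind several times along a shorter pattern of edges. -/
theorem eq_one_of_pattern {n m : ℕ} (hC : SimpleCurve x σ (n * m))
    (hσ : ∀ k, σ (k + m) = σ k)
    (hd : ∀ k, x (k + m + 1) < x (k + m) ↔ x (k + 1) < x k) : n = 1 := by
  obtain ⟨c, hc⟩ : ∃ c, ∀ k, x c ≤ x k := by
    obtain ⟨c, hc⟩ := Nat.sInf_mem (Set.range_nonempty x)
    exact ⟨c, fun k => hc ▸ Nat.sInf_le ⟨k, rfl⟩⟩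
  have hS := hC.shift c
  set y := fun k => x (c + k) with hy
  set ν := fun k => σ (c + k) with hν
  have hνm : ∀ k, ν (k + m) = ν k := fun k => by
    simpa only [hν, add_assoc] using hσ (c + k)
  have hdm : ∀ k, y (k + m + 1) < y (k + m) ↔ y (k + 1) < y k := fun k => by
    simpa only [hy, add_assoc] using hd (c + k)
  have hper : ∀ k, turning y ν (k + m) = turning y ν k := by
    intro k
    have a1 := hνm (k + 1)
    have b1 := hdm (k + 1)
    rw [show k + 1 + m = k + m + 1 by ring] at a1 b1
    rw [hS.turning_eq, hS.turning_eq, a1, hνm]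
    simp only [hdm, show k + m + 2 = k + m + 1 + 1 from rfl, b1]
  have hmul : ∀ j, ∑ s ∈ Finset.range (j * m), turning y ν s =
      j * ∑ s ∈ Finset.range m, turning y ν s := by
    have hshift : ∀ j k, turning y ν (j * m + k) = turning y ν k := by
      intro j k
      induction j with
      | zero => simp
      | succ j ih => rw [← ih, ← hper (j * m + k)]; congr 1; ring
    intro j
    induction j with
    | zero => simp
    | succ j ih =>
      rw [Nat.succ_mul, Finset.sum_range_add, ih]
      simp only [hshift]
      push_cast
      ring
  have heven : ∃ z : ℤ, ∑ s ∈ Finset.range m, turning y ν s = 2 * z := by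
    have h1 : ∀ k, ∃ z : ℤ, ∑ s ∈ Finset.range k, turning y ν s =
        (if y 1 < y 0 then 1 else 0) - (if y (k + 1) < y k then 1 else 0) + 2 * z := by
      intro k
      induction k with
      | zero => exact ⟨0, by simp⟩
      | succ k ih =>
        obtain ⟨z, hz⟩ := ih
        obtain ⟨z', hz'⟩ := hS.turning_parity k
        refine ⟨z + z', ?_⟩
        rw [Finset.sum_range_succ, hz, hz']
        ring
    obtain ⟨z, hz⟩ := h1 m
    refine ⟨z, ?_⟩
    have := hdm 0
    rw [Nat.zero_add] at this
    simpa [this] using hz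
  obtain ⟨z, hz⟩ := heven
  have h2 := hS.sum_turning_of_min (fun k => hc (c + k))
  rw [hmul, hz] at h2
  have hdvd : (n : ℤ) ∣ 1 := by
    rcases h2 with h | h
    · exact ⟨z, by linarith⟩
    · exact ⟨-z, by linarith⟩
  exact Nat.dvd_one.1 (by exact_mod_cast hdvd)

end SimpleCurve

section Heights

variable {K : ℕ} {A : Type}

open Classical in
/-- The effect of a letter on the height of the stack `s`. -/
noncomputable def stackWeight (h : CRAlphabet K A) (s : Fin K) (a : A) : ℤ :=
  if a ∈ h.callSet s then 1 else if a ∈ h.retSet s then -1 else 0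

theorem stackWeight_call {h : CRAlphabet K A} {s : Fin K} {a : A} (ha : a ∈ h.callSet s) :
    stackWeight h s a = 1 := by simp [stackWeight, ha]

theorem stackWeight_ret {h : CRAlphabet K A} {s : Fin K} {a : A} (ha : a ∈ h.retSet s) :
    stackWeight h s a = -1 := by
  have : a ∉ h.callSet s := by
    intro hc
    have h1 : h.kind a = .call s := hc
    have h2 : h.kind a = .ret s := ha
    simp [h1] at h2
  simp [stackWeight, ha, this]

/-- The height of the stack `s` after reading `u`. -/
noncomputable def stackHeight (h : CRAlphabet K A) (s : Fin K) (u : List A) : ℤ :=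
  (u.map (stackWeight h s)).sum

theorem stackHeight_append (h : CRAlphabet K A) (s : Fin K) (u v : List A) :
    stackHeight h s (u ++ v) = stackHeight h s u + stackHeight h s v := by
  simp [stackHeight]

theorem stackHeight_singleton (h : CRAlphabet K A) (s : Fin K) (a : A) :
    stackHeight h s [a] = stackWeight h s a := by
  simp [stackHeight]

theorem SWellFormed.stackHeight_eq {h : CRAlphabet K A} {s : Fin K} {u : List A}
    (hu : SWellFormed (h.callSet s) (h.retSet s) u) :
    stackHeight h s u = 0 ∧ ∀ k, 0 ≤ stackHeight h s (u.take k) := by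
  induction hu with
  | nil => simp [stackHeight]
  | single hc hr =>
    refine ⟨by simp [stackHeight, stackWeight, hc, hr], fun k => ?_⟩
    cases k <;> simp [stackHeight, stackWeight, hc, hr]
  | @wrap a b u ha hb _ ih =>
    obtain ⟨h0, hp⟩ := ih
    have ha' : ∀ v, stackHeight h s (a :: v) = 1 + stackHeight h s v := by
      intro v
      simp [stackHeight, stackWeight_call ha]
    have hb' := stackWeight_ret hb
    constructor
    · rw [List.cons_append, ha', stackHeight_append, h0, stackHeight_singleton, hb']
      norm_num
    · intro k
      cases k with
      | zero => simp [stackHeight]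
      | succ k =>
        rw [List.cons_append, List.take_succ_cons, ha', List.take_append, stackHeight_append]
        have h1 := hp k
        have h2 : -1 ≤ stackHeight h s ([b].take (k - u.length)) := by
          cases k - u.length <;> simp [stackHeight, hb']
        omega
  | concat _ _ ih1 ih2 =>
    refine ⟨by rw [stackHeight_append, ih1.1, ih2.1, add_zero], fun k => ?_⟩
    rw [List.take_append, stackHeight_append]
    exact add_nonneg (ih1.2 _) (ih2.2 _)

theorem stackHeight_take_succ (h : CRAlphabet K A) (s : Fin K) {w : List A} {i : ℕ} {a : A}
    (hi : w[i]? = some a) :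
    stackHeight h s (w.take (i + 1)) = stackHeight h s (w.take i) + stackWeight h s a := by
  rw [List.take_add_one, stackHeight_append, hi]
  simp [stackHeight]

variable {h : CRAlphabet K A} {w : List A} {s : Fin K} {i j : ℕ}

/-- Strictly inside a matched pair, the stack is higher than at its two ends. -/
theorem Matched.stackHeight_bounds (hm : Matched h w s i j) :
    stackHeight h s (w.take (j + 1)) = stackHeight h s (w.take i) ∧
    ∀ p, i < p → p ≤ j → stackHeight h s (w.take i) + 1 ≤ stackHeight h s (w.take p) := by
  obtain ⟨hij, _, ⟨a, hia, ha⟩, ⟨b, hjb, hb⟩, hwf⟩ := hm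
  have hsplit : ∀ p, i < p → p ≤ j → w.take p =
      w.take (i + 1) ++ ((w.take j).drop (i + 1)).take (p - (i + 1)) := by
    intro p h1 h2
    rw [List.take_drop, List.take_take, show min (i + 1 + (p - (i + 1))) j = p by omega]
    conv_lhs => rw [← List.take_append_drop (i + 1) (w.take p)]
    rw [List.take_take, show min (i + 1) p = i + 1 by omega]
  have h1 := stackHeight_take_succ h s hia
  rw [stackWeight_call ha] at h1
  refine ⟨?_, fun p hp hpj => ?_⟩
  · rw [stackHeight_take_succ h s hjb, stackWeight_ret hb, hsplit j hij le_rfl,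
      List.take_of_length_le (l := (w.take j).drop (i + 1)) (by simp; omega), stackHeight_append, hwf.stackHeight_eq.1, h1]
    ring
  · rw [hsplit p hp hpj, stackHeight_append, h1]
    have := hwf.stackHeight_eq.2 (p - (i + 1))
    omega

theorem Matched.not_crossing {k l : ℕ} (hm : Matched h w s i j) (hm' : Matched h w s k l) :
    ¬ (i < k ∧ k < j ∧ j < l) := by
  rintro ⟨h1, h2, h3⟩
  have a1 := hm.stackHeight_bounds.2 k h1 h2.le
  have a2 := hm'.stackHeight_bounds.2 (j + 1) (by omega) (by omega)
  have a3 := hm.stackHeight_bounds.1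
  omega

theorem Matched.right_le {l : ℕ} (hm : Matched h w s i j) (hm' : Matched h w s i l) : l ≤ j := by
  by_contra! hlt
  have a1 := hm'.stackHeight_bounds.2 (j + 1) (by have := hm.1; omega) (by omega)
  have a2 := hm.stackHeight_bounds.1
  omega

theorem Matched.le_left {k : ℕ} (hm : Matched h w s i j) (hm' : Matched h w s k j) : i ≤ k := by
  by_contra! hlt
  have a1 := hm'.stackHeight_bounds.2 i hlt hm.1.le
  have a2 := hm.stackHeight_bounds.1
  have a3 := hm'.stackHeight_bounds.1
  omega

theorem Matched.kind_left (hm : Matched h w s i j) : w[i]?.map h.kind = some (.call s) := by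
  obtain ⟨_, _, ⟨a, hia, ha⟩, _⟩ := hm
  rw [hia]
  exact congrArg some ha

theorem Matched.kind_right (hm : Matched h w s i j) : w[j]?.map h.kind = some (.ret s) := by
  obtain ⟨_, _, _, ⟨a, hia, ha⟩, _⟩ := hm
  rw [hia]
  exact congrArg some ha

theorem MuAny.right_unique {l : ℕ} (hm : MuAny h w i j) (hm' : MuAny h w i l) : j = l := by
  obtain ⟨s, hs⟩ := hm
  obtain ⟨t, ht⟩ := hm'
  have := hs.kind_left.symm.trans ht.kind_left
  simp only [Option.some.injEq, CRKind.call.injEq] at this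
  subst this
  exact le_antisymm (ht.right_le hs) (hs.right_le ht)

theorem MuAny.left_unique {k : ℕ} (hm : MuAny h w i j) (hm' : MuAny h w k j) : i = k := by
  obtain ⟨s, hs⟩ := hm
  obtain ⟨t, ht⟩ := hm'
  have := hs.kind_right.symm.trans ht.kind_right
  simp only [Option.some.injEq, CRKind.ret.injEq] at this
  subst this
  exact le_antisymm (hs.le_left ht) (ht.le_left hs)

theorem MuAny.not_right {k : ℕ} (hm : MuAny h w i j) : ¬ MuAny h w j k := by
  rintro ⟨t, ht⟩
  obtain ⟨s, hs⟩ := hm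
  have := hs.kind_right.symm.trans ht.kind_left
  simp at this

theorem MuAny.lt (hm : MuAny h w i j) : i < j := by
  obtain ⟨s, hs⟩ := hm
  exact hs.1

theorem MuAny.lt_length (hm : MuAny h w i j) : j < w.length := by
  obtain ⟨s, hs⟩ := hm
  exact hs.2.1

end Heights

/-- A direction in a nested word: along an edge of the linear order (`false`) or of the matching
relation (`true`), forwards (`true`) or backwards (`false`). -/
abbrev Dir := Bool × Bool

/-- The opposite direction. -/
def Dir.inv (d : Dir) : Dir := (d.1, !d.2)

section Walks

variable {K : ℕ} {A : Type}

/-- The step from `i` in direction `d` leads to `j`. -/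
def StepRel (h : CRAlphabet K A) (w : List A) : Dir → ℕ → ℕ → Prop
  | (false, true), i, j => j = i + 1 ∧ j < w.length
  | (false, false), i, j => i = j + 1 ∧ i < w.length
  | (true, true), i, j => MuAny h w i j
  | (true, false), i, j => MuAny h w j i

variable {h : CRAlphabet K A} {w : List A} {d : Dir} {i j k : ℕ}

theorem StepRel.inv (hs : StepRel h w d i j) : StepRel h w d.inv j i := by
  obtain ⟨_ | _, _ | _⟩ := d <;> exact hs

theorem StepRel.unique (hs : StepRel h w d i j) (hs' : StepRel h w d i k) : j = k := by
  obtain ⟨_ | _, _ | _⟩ := d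
  · exact Nat.succ.inj (hs.1.symm.trans hs'.1)
  · exact hs.1.trans hs'.1.symm
  · exact hs.left_unique hs'
  · exact hs.right_unique hs'

theorem StepRel.lt_length (hs : StepRel h w d i j) : i < w.length ∧ j < w.length := by
  obtain ⟨_ | _, _ | _⟩ := d
  · obtain ⟨h1, h2⟩ := hs; omega
  · obtain ⟨h1, h2⟩ := hs; omega
  · have h1 : j < i := hs.lt
    have h2 := hs.lt_length; omega
  · have h1 : i < j := hs.lt
    have h2 := hs.lt_length; omega

theorem StepRel.lt_iff (hs : StepRel h w d i j) : j < i ↔ d.2 = false := by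
  obtain ⟨_ | _, _ | _⟩ := d
  · obtain ⟨h1, h2⟩ := hs; simp; omega
  · obtain ⟨h1, h2⟩ := hs; simp; omega
  · have h1 : j < i := hs.lt
    simpa using h1
  · have h1 : i < j := hs.lt
    simpa using h1.le

theorem StepRel.ne (hs : StepRel h w d i j) : i ≠ j := by
  rintro rfl
  have h1 := hs.lt_iff
  have h2 := hs.inv.lt_iff
  simp [Dir.inv] at h1 h2
  simp [h1] at h2

theorem adj_iff : Adj h w i j ↔ ∃ d, StepRel h w d i j := by
  constructor
  · rintro (h1 | h1 | h1 | h1)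
    exacts [⟨(false, true), h1⟩, ⟨(false, false), h1⟩, ⟨(true, true), h1⟩, ⟨(true, false), h1⟩]
  · rintro ⟨⟨_ | _, _ | _⟩, hs⟩
    exacts [.inr (.inl hs), .inl hs, .inr (.inr (.inr hs)), .inr (.inr (.inl hs))]

open Classical in
/-- The position reached from `i` by a step in direction `d`, if there is one. -/
noncomputable def move (h : CRAlphabet K A) (w : List A) (d : Dir) (i : ℕ) : Option ℕ :=
  if hs : ∃ j, StepRel h w d i j then some hs.choose else none

theorem move_eq_some : move h w d i = some j ↔ StepRel h w d i j := by
  unfold move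
  split_ifs with hs
  · rw [Option.some.injEq]
    exact ⟨fun e => e ▸ hs.choose_spec, fun e => hs.choose_spec.unique e⟩
  · exact ⟨False.elim, fun e => (hs ⟨j, e⟩).elim⟩

theorem move_eq_none : move h w d i = none ↔ ∀ j, ¬ StepRel h w d i j := by
  rw [Option.eq_none_iff_forall_ne_some]
  exact forall_congr' fun j => not_congr move_eq_some

theorem move_inv (hm : move h w d i = some j) : move h w d.inv j = some i :=
  move_eq_some.2 (move_eq_some.1 hm).inv

/-- The position reached from `i` by following a list of directions, if there is one. -/
noncomputable def walk (h : CRAlphabet K A) (w : List A) : List Dir → ℕ → Option ℕ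
  | [], i => some i
  | d :: u, i => (move h w d i).bind (walk h w u)

variable {u v : List Dir}

theorem walk_append : walk h w (u ++ v) i = (walk h w u i).bind (walk h w v) := by
  induction u generalizing i with
  | nil => rfl
  | cons d u ih =>
    simp only [List.cons_append, walk]
    cases move h w d i with
    | none => rfl
    | some j => simpa using ih

theorem walk_singleton : walk h w [d] i = move h w d i := by
  simp only [walk]
  cases move h w d i <;> rfl

theorem walk_append_of_some (hu : walk h w u i = some j) (hv : walk h w v j = some k) :
    walk h w (u ++ v) i = some k := by
  rw [walk_append, hu]
  exact hv

theorem walk_concat (hu : walk h w u i = some j) : walk h w (u ++ [d]) i = move h w d j := by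
  rw [walk_append, hu]
  exact walk_singleton

/-- The list of directions leading back. -/
def backtrack (u : List Dir) : List Dir := (u.map Dir.inv).reverse

theorem length_backtrack : (backtrack u).length = u.length := by simp [backtrack]

theorem walk_backtrack (hu : walk h w u i = some j) : walk h w (backtrack u) j = some i := by
  induction u generalizing i with
  | nil =>
    cases hu
    rfl
  | cons d u ih =>
    simp only [walk, Option.bind_eq_some_iff] at hu
    obtain ⟨k, hk, hu⟩ := hu
    have : backtrack (d :: u) = backtrack u ++ [d.inv] := by simp [backtrack]
    rw [this, walk_concat (ih hu), move_inv hk]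

theorem eq_or_lt_of_walk (hu : walk h w u i = some j) :
    i = j ∨ (i < w.length ∧ j < w.length) := by
  induction u generalizing i with
  | nil =>
    cases hu
    exact .inl rfl
  | cons d u ih =>
    simp only [walk, Option.bind_eq_some_iff] at hu
    obtain ⟨k, hk, hu⟩ := hu
    have := (move_eq_some.1 hk).lt_length
    rcases ih hu with rfl | h1
    · exact .inr this
    · exact .inr ⟨this.1, h1.2⟩

theorem distLE_iff {r : ℕ} : DistLE h w r i j ↔ ∃ u, u.length ≤ r ∧ walk h w u i = some j := by
  induction r generalizing i with
  | zero =>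
    constructor
    · rintro rfl
      exact ⟨[], le_rfl, rfl⟩
    · rintro ⟨u, hu, hw⟩
      obtain rfl := List.length_eq_zero_iff.1 (Nat.le_zero.1 hu)
      exact Option.some.inj hw
  | succ r ih =>
    constructor
    · rintro (rfl | ⟨k, hk, hr⟩)
      · exact ⟨[], by simp, rfl⟩
      · obtain ⟨d, hd⟩ := adj_iff.1 hk
        obtain ⟨u, hu, hw⟩ := ih.1 hr
        exact ⟨d :: u, by simpa using hu, by simp [walk, move_eq_some.2 hd, hw]⟩
    · rintro ⟨_ | ⟨d, u⟩, hu, hw⟩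
      · exact .inl (Option.some.inj hw)
      · simp only [walk, Option.bind_eq_some_iff] at hw
        obtain ⟨k, hk, hw⟩ := hw
        exact .inr ⟨k, adj_iff.2 ⟨d, move_eq_some.1 hk⟩, ih.2 ⟨u, by simpa using hu, hw⟩⟩

end Walks

section Coloring

variable {K : ℕ} {A C : Type}

/-- A coloring that separates any two positions at distance at most `P`. -/
def ProperColoring (h : CRAlphabet K A) (P : ℕ) (w : List A) (c : ℕ → C) : Prop :=
  ∀ u i j, u.length ≤ P → walk h w u i = some j → c i = c j → i = j

/-- A bounded number of colors suffices for a proper coloring. -/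
theorem exists_properColoring (h : CRAlphabet K A) (P : ℕ) :
    ∃ M : ℕ, 0 < M ∧ ∀ w : List A, ∃ c : ℕ → Fin M, ProperColoring h P w c := by
  classical
  have hfin : {u : List Dir | u.length ≤ P}.Finite := List.finite_length_le Dir P
  set S := hfin.toFinset with hS
  refine ⟨S.card + 1, Nat.succ_pos _, fun w => ?_⟩
  have key : ∀ n : ℕ, ∃ c : ℕ → Fin (S.card + 1), ∀ u i j, u.length ≤ P →
      walk h w u i = some j → i < n → j < n → c i = c j → i = j := by
    intro n
    induction n with
    | zero => exact ⟨fun _ => 0, fun _ _ _ _ _ hi => absurd hi (Nat.not_lt_zero _)⟩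
    | succ n ih =>
      obtain ⟨c, hc⟩ := ih
      obtain ⟨a, ha⟩ : ∃ a, a ∉ S.image fun u => c ((walk h w u n).getD 0) := by
        by_contra! hall
        have h1 := Finset.card_le_card (fun a _ => hall a : Finset.univ ⊆ _)
        have h2 := Finset.card_image_le (s := S) (f := fun u => c ((walk h w u n).getD 0))
        rw [Finset.card_univ, Fintype.card_fin] at h1
        omega
      have hnew : ∀ u j, u.length ≤ P → walk h w u n = some j → a ≠ c j := by
        rintro u j hu hw rfl
        exact ha (Finset.mem_image.2 ⟨u, by simpa [hS] using hu, by rw [hw]; rfl⟩)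
      refine ⟨Function.update c n a, fun u i j hu hw hi hj he => ?_⟩
      rcases eq_or_ne i n with rfl | hin <;> rcases eq_or_ne j i with rfl | hjn
      · rfl
      · rw [Function.update_self, Function.update_of_ne hjn] at he
        exact absurd he (hnew u j hu hw)
      · rfl
      · rcases eq_or_ne j n with rfl | hjn'
        · rw [Function.update_self, Function.update_of_ne hin] at he
          exact absurd he.symm (hnew _ i (length_backtrack.trans_le hu) (walk_backtrack hw))
        · rw [Function.update_of_ne hin, Function.update_of_ne hjn'] at he
          exact hc u i j hu hw (by omega) (by omega) he
  obtain ⟨c, hc⟩ := key w.length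
  refine ⟨c, fun u i j hu hw he => ?_⟩
  rcases eq_or_lt_of_walk hw with h1 | ⟨h1, h2⟩
  · exact h1
  · exact hc u i j hu hw h1 h2 he

/-- The letter and the color of a position. -/
def label (w : List A) (c : ℕ → C) (i : ℕ) : Option A × C := (w[i]?, c i)

/-- The labels of the positions around `i`, as seen from `i` along all lists of directions of
length at most `R`. -/
noncomputable def view (h : CRAlphabet K A) (R : ℕ) (w : List A) (c : ℕ → C) (i : ℕ) :
    {u : List Dir // u.length ≤ R} → Option (Option A × C) :=
  fun u => (walk h w u.1 i).map (label w c)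

/-- Two positions of colored nested words look alike up to distance `R`. -/
def SameView (h : CRAlphabet K A) (R : ℕ) (v : List A) (c : ℕ → C) (p : ℕ)
    (w : List A) (e : ℕ → C) (i : ℕ) : Prop :=
  ∀ u, u.length ≤ R → (walk h v u p).map (label v c) = (walk h w u i).map (label w e)

end Coloring

section Closing

/-- The side of the line on which the arcs of a letter of the given kind are drawn. -/
def arcSide : Option (CRKind 2) → ℤ
  | some (.call s) => if s = 0 then 1 else -1
  | some (.ret s) => if s = 0 then 1 else -1
  | _ => 0

variable {A C : Type} {h : CRAlphabet 2 A} {w : List A}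

theorem StepRel.matched {d : Dir} {i j : ℕ} (hs : StepRel h w d i j) (hd : d.1 = true) :
    ∃ s : Fin 2, arcSide (w[i]?.map h.kind) = (if s = 0 then 1 else -1) ∧
      Matched h w s (min i j) (max i j) := by
  obtain ⟨_ | _, _ | _⟩ := d
  · cases hd
  · cases hd
  · obtain ⟨s, hm⟩ := hs
    refine ⟨s, by rw [hm.kind_right]; rfl, ?_⟩
    rwa [min_eq_right hm.1.le, max_eq_left hm.1.le]
  · obtain ⟨s, hm⟩ := hs
    refine ⟨s, by rw [hm.kind_left]; rfl, ?_⟩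
    rwa [min_eq_left hm.1.le, max_eq_right hm.1.le]

theorem StepRel.arc_unique {d e : Dir} {i j k : ℕ} (hs : StepRel h w d i j)
    (hs' : StepRel h w e j k) (hd : d.1 = true) (he : e.1 = true) : i = k := by
  obtain ⟨_ | _, _ | _⟩ := d <;> obtain ⟨_ | _, _ | _⟩ := e <;> try cases hd <;> try cases he
  · exact (MuAny.not_right hs' hs).elim
  · exact MuAny.right_unique hs hs'
  · exact MuAny.left_unique hs hs'
  · exact (MuAny.not_right hs hs').elim

/-- A closed walk along edges of a `2`-stack nested word, without repeated positions, is a simple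
closed curve. -/
theorem simpleCurve_of_walk {x : ℕ → ℕ} {d : ℕ → Dir} {N : ℕ} (hN : 3 ≤ N)
    (hx : ∀ k, x (k + N) = x k) (hd : ∀ k, d (k + N) = d k)
    (hstep : ∀ k, StepRel h w (d k) (x k) (x (k + 1)))
    (hinj : ∀ a b, x a = x b → a % N = b % N) :
    SimpleCurve x (fun k => if (d k).1 then arcSide (w[x k]?.map h.kind) else 0) N where
  three_le := hN
  period := hx
  sidePeriod k := by simp only [hd, hx]
  inj := hinj
  side k := by
    split_ifs with hk
    · obtain ⟨s, hs, -⟩ := (hstep k).matched hk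
      rw [hs]
      split_ifs <;> simp
    · simp
  line k := by
    split_ifs with hk
    · obtain ⟨s, hs, -⟩ := (hstep k).matched hk
      rw [hs]
      split_ifs <;> simp
    · intro _
      have hs := hstep k
      generalize d k = e at hk hs
      obtain ⟨_ | _, _ | _⟩ := e
      · exact .inr hs.1
      · exact .inl hs.1
      · exact (hk rfl).elim
      · exact (hk rfl).elim
  alternate k := by
    by_contra! hk
    have h1 : (d k).1 = true := by
      by_contra hne
      exact hk.1 (if_neg hne)
    have h2 : (d (k + 1)).1 = true := by
      by_contra hne
      exact hk.2 (if_neg hne)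
    have h3 := (hstep k).arc_unique (hstep (k + 1)) h1 h2
    have h4 : N ∣ k + 1 + 1 - k := (Nat.modEq_iff_dvd' (by omega)).1 (hinj _ _ h3)
    have := Nat.le_of_dvd (by omega) h4
    omega
  noncrossing s t := by
    intro he hne
    have h1 : (d s).1 = true := by
      by_contra hns
      exact hne (if_neg hns)
    have h2 : (d t).1 = true := by
      by_contra hns
      exact hne (he.trans (if_neg hns))
    obtain ⟨a, ha, hma⟩ := (hstep s).matched h1
    obtain ⟨b, hb, hmb⟩ := (hstep t).matched h2
    rw [if_pos h1, if_pos h2, ha, hb] at he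
    have hside : ∀ a b : Fin 2,
        (if a = 0 then (1 : ℤ) else -1) = (if b = 0 then 1 else -1) → a = b := by decide
    obtain rfl := hside a b he
    exact hma.not_crossing hmb

theorem exists_path {u : List Dir} {i j : ℕ} (hu : walk h w u i = some j) :
    ∃ y : ℕ → ℕ, y 0 = i ∧ y u.length = j ∧
      ∀ k < u.length, StepRel h w (u.getD k default) (y k) (y (k + 1)) := by
  induction u generalizing i with
  | nil => exact ⟨fun _ => i, rfl, Option.some.inj hu, by simp⟩
  | cons d u ih =>
    simp only [walk, Option.bind_eq_some_iff] at hu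
    obtain ⟨k, hk, hu⟩ := hu
    obtain ⟨y, h0, hl, hs⟩ := ih hu
    refine ⟨fun t => Nat.casesOn t i y, rfl, hl, fun t ht => ?_⟩
    cases t with
    | zero =>
      change StepRel h w d i (y 0)
      rw [h0]
      exact move_eq_some.1 hk
    | succ t => exact hs t (by simpa using ht)

theorem exists_walk {x : ℕ → ℕ} {d : ℕ → Dir} {a l : ℕ}
    (hs : ∀ t, a ≤ t → t < a + l → StepRel h w (d t) (x t) (x (t + 1))) :
    ∃ u : List Dir, u.length = l ∧ walk h w u (x a) = some (x (a + l)) := by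
  induction l with
  | zero => exact ⟨[], rfl, rfl⟩
  | succ l ih =>
    obtain ⟨u, hl, hu⟩ := ih fun t h1 h2 => hs t h1 (by omega)
    exact ⟨u ++ [d (a + l)], by simp [hl],
      by rw [walk_concat hu]; exact move_eq_some.2 (hs _ (by omega) (by omega))⟩

/-- An infinite walk that repeats a pattern of directions of length `m`, such that positions are
only revisited after a multiple of `m` steps, has period `m`. -/
theorem eq_of_pattern {x : ℕ → ℕ} {d : ℕ → Dir} {m : ℕ} (hm : 0 < m)
    (hd : ∀ k, d (k + m) = d k) (hstep : ∀ k, StepRel h w (d k) (x k) (x (k + 1)))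
    (hletter : ∀ k, w[x (k + m)]? = w[x k]?) (hmod : ∀ a b, x a = x b → a % m = b % m) :
    x 0 = x m := by
  classical
  have hdn : ∀ n k, d (k + n * m) = d k := by
    intro n k
    induction n with
    | zero => simp
    | succ n ih => rw [← ih, ← hd (k + n * m)]; congr 1; ring
  have hback : ∀ k n, x k = x (k + n * m) → x 0 = x (n * m) := by
    intro k n hk
    induction k with
    | zero => simpa using hk
    | succ k ih =>
      apply ih
      have h1 := (hstep k).inv
      have h2 := (hstep (k + n * m)).inv
      rw [hdn, show k + n * m + 1 = k + 1 + n * m by ring, ← hk] at h2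
      exact h1.unique h2
  have hdiv : ∀ a b, a < b → x a = x b → ∃ n, 0 < n ∧ b = a + n * m := by
    intro a b hab he
    obtain ⟨n, hn⟩ := (Nat.modEq_iff_dvd' hab.le).1 (hmod a b he)
    refine ⟨n, Nat.pos_of_ne_zero ?_, by rw [mul_comm]; omega⟩
    rintro rfl
    omega
  have hex : ∃ n, 0 < n ∧ x 0 = x (n * m) := by
    obtain ⟨a, b, hne, he⟩ := Finite.exists_ne_map_eq_of_infinite
      fun k => (⟨x k, (hstep k).lt_length.1⟩ : Fin w.length)
    replace he : x a = x b := congrArg Fin.val he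
    wlog hab : a < b generalizing a b
    · exact this b a hne.symm he.symm (by omega)
    obtain ⟨n, hn, rfl⟩ := hdiv a b hab he
    exact ⟨n, hn, hback a n he⟩
  obtain ⟨hn, hxn⟩ := Nat.find_spec hex
  have hmin := fun k => @Nat.find_min _ _ hex k
  set n := Nat.find hex
  have hper : ∀ k, x (k + n * m) = x k := by
    intro k
    induction k with
    | zero => simpa using hxn.symm
    | succ k ih =>
      have h2 := hstep (k + n * m)
      rw [hdn, ih] at h2
      rw [show k + 1 + n * m = k + n * m + 1 by ring]
      exact h2.unique (hstep k)
  by_contra hne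
  have hn2 : 2 ≤ n := by
    by_contra hlt
    have : n = 1 := by omega
    rw [this, one_mul] at hxn
    exact hne hxn
  have h3 : 3 ≤ n * m := by
    by_contra hlt
    have h1 : n * m = 2 := by nlinarith
    have h2 : m = 1 := by nlinarith
    have s0 := hstep 0
    have s1 := hstep 1
    have hd0 := hd 0
    rw [h2] at hd0
    rw [h1] at hxn
    rw [hd0, show 1 + 1 = 2 from rfl, ← hxn] at s1
    have l0 := s0.lt_iff
    have l1 := s1.lt_iff
    have l2 := s0.ne
    rw [zero_add] at l0 l2
    rw [← l1] at l0
    omega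
  have hlow : ∀ a b, a < b → b < n * m → x a ≠ x b := by
    intro a b hlt hb he
    obtain ⟨q, hq, rfl⟩ := hdiv a b hlt he
    exact hmin q (Nat.lt_of_mul_lt_mul_right (show q * m < n * m by omega)) ⟨hq, hback a q he⟩
  have hinj : ∀ a b, x a = x b → a % (n * m) = b % (n * m) := by
    have hxmod : ∀ a, x (a % (n * m)) = x a := Function.Periodic.map_mod_nat hper
    intro a b he
    rw [← hxmod a, ← hxmod b] at he
    have ha := Nat.mod_lt a (show n * m > 0 by omega)
    have hb := Nat.mod_lt b (show n * m > 0 by omega)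
    rcases lt_trichotomy (a % (n * m)) (b % (n * m)) with hlt | heq | hlt
    · exact (hlow _ _ hlt hb he).elim
    · exact heq
    · exact (hlow _ _ hlt ha he.symm).elim
  have hC := simpleCurve_of_walk h3 hper (hdn n) hstep hinj
  have := hC.eq_one_of_pattern (fun k => by simp only [hd, hletter])
    (fun k => by rw [(hstep (k + m)).lt_iff, hd, (hstep k).lt_iff])
  omega

/-- In a `2`-stack nested word, a coloring is proper if positions at bounded distance with the
same color have the same neighborhoods. -/
theorem properColoring_of_neighborhoods {P : ℕ} {c : ℕ → C}
    (H : ∀ u i j, u.length ≤ P → walk h w u i = some j → c i = c j →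
      label w c i = label w c j ∧
      ∀ d, (move h w d i).map (label w c) = (move h w d j).map (label w c)) :
    ProperColoring h P w c := by
  suffices hmain : ∀ m ≤ P, ∀ u i j, u.length = m → walk h w u i = some j → c i = c j → i = j from
    fun u i j hu => hmain u.length hu u i j rfl
  intro m
  induction m using Nat.strong_induction_on with
  | _ m ih =>
  intro hmP u i j hu hw hc
  rcases Nat.eq_zero_or_pos m with rfl | hm
  · obtain rfl := List.length_eq_zero_iff.1 hu
    exact Option.some.inj hw
  obtain ⟨y, hy0, hym, hy⟩ := exists_path hw
  rw [hu] at hym hy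
  obtain ⟨d, hd⟩ : ∃ d : ℕ → Dir, d = fun k => u.getD (k % m) default := ⟨_, rfl⟩
  obtain ⟨x, hx0, hxs⟩ : ∃ x : ℕ → ℕ, x 0 = i ∧
      ∀ k, x (k + 1) = (move h w (d k) (x k)).getD 0 :=
    ⟨fun k => Nat.rec i (fun k y => (move h w (d k) y).getD 0) k, rfl, fun _ => rfl⟩
  have hdm : ∀ k, d (k + m) = d k := by simp [hd]
  have hstep_of : ∀ k z, StepRel h w (d k) (x k) z → x (k + 1) = z := by
    intro k z hz
    rw [hxs, move_eq_some.2 hz]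
    rfl
  have hxy : ∀ k ≤ m, x k = y k := by
    intro k hk
    induction k with
    | zero => rw [hx0, hy0]
    | succ k ihk =>
      apply hstep_of
      rw [ihk (by omega), hd]
      simp only [Nat.mod_eq_of_lt hk]
      exact hy k hk
  have hfirst : ∀ k < m, StepRel h w (d k) (x k) (x (k + 1)) := by
    intro k hk
    rw [hxy k hk.le, hxy (k + 1) hk, hd]
    simp only [Nat.mod_eq_of_lt hk]
    exact hy k hk
  have hxm : x m = j := (hxy m le_rfl).trans hym
  have hall : ∀ k, (∀ t < k + m, StepRel h w (d t) (x t) (x (t + 1))) ∧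
      c (x k) = c (x (k + m)) := by
    intro k
    induction k with
    | zero => simpa [hx0, hxm, hc] using hfirst
    | succ k ihk =>
      obtain ⟨hs, hcol⟩ := ihk
      obtain ⟨u', hu', hw'⟩ := exists_walk (a := k) (l := m) fun t _ ht => hs t ht
      have hmv := (H u' _ _ (hu'.trans_le hmP) hw' hcol).2 (d k)
      rw [move_eq_some.2 (hs k (by omega)), Option.map_some, eq_comm,
        Option.map_eq_some_iff] at hmv
      obtain ⟨z, hz, hlab⟩ := hmv
      rw [move_eq_some, ← hdm] at hz
      have hxz := hstep_of _ _ hz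
      rw [← hxz] at hz hlab
      refine ⟨fun t ht => ?_, ?_⟩
      · rcases Nat.lt_or_ge t (k + m) with h1 | h1
        · exact hs t h1
        · obtain rfl : t = k + m := by omega
          exact hz
      · rw [show k + 1 + m = k + m + 1 by ring]
        exact (congrArg Prod.snd hlab).symm
  have hstep : ∀ k, StepRel h w (d k) (x k) (x (k + 1)) := fun k => (hall k).1 k (by omega)
  have hcper : ∀ k, c (x (k + m)) = c (x k) := fun k => (hall k).2.symm
  have hletter : ∀ k, w[x (k + m)]? = w[x k]? := by
    intro k
    obtain ⟨u', hu', hw'⟩ := exists_walk (a := k) (l := m) fun t _ _ => hstep t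
    exact congrArg Prod.fst (H u' _ _ (hu'.trans_le hmP) hw' (hall k).2).1.symm
  rw [← hx0, ← hxm]
  by_contra hne
  have hnem : ∀ k, x k ≠ x (k + m) := by
    intro k
    induction k with
    | zero => simpa using hne
    | succ k ihk =>
      intro he
      apply ihk
      have h1 := (hstep k).inv
      have h2 := (hstep (k + m)).inv
      rw [hdm, show k + m + 1 = k + 1 + m by ring, ← he] at h2
      exact h1.unique h2
  have hshort : ∀ a l, l < m → c (x a) = c (x (a + l)) → x a = x (a + l) := by
    intro a l hl he
    obtain ⟨u', hu', hw'⟩ := exists_walk (a := a) (l := l) fun t _ _ => hstep t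
    exact ih l hl (hl.le.trans hmP) u' _ _ hu' hw' he
  have hdist : ∀ a l, 0 < l → l < m → c (x a) ≠ c (x (a + l)) := by
    intro a l h0 hl he
    have h1 := hshort a l hl he
    have h2 := hshort (a + l) (m - l) (by omega)
    rw [show a + l + (m - l) = a + m by omega, hcper] at h2
    exact hnem a (h1.trans (h2 he.symm))
  have hlow : ∀ a b, a < b → b < m → c (x a) ≠ c (x b) := by
    intro a b hlt hb
    have := hdist a (b - a) (by omega) (by omega)
    rwa [show a + (b - a) = b by omega] at this
  have hmod : ∀ a b, x a = x b → a % m = b % m := by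
    have hcmod : ∀ a, c (x (a % m)) = c (x a) :=
      Function.Periodic.map_mod_nat (f := fun k => c (x k)) hcper
    intro a b he
    have he := congrArg c he
    rw [← hcmod a, ← hcmod b] at he
    have ha := Nat.mod_lt a hm
    have hb := Nat.mod_lt b hm
    rcases lt_trichotomy (a % m) (b % m) with hlt | heq | hlt
    · exact (hlow _ _ hlt hb he).elim
    · exact heq
    · exact (hlow _ _ hlt ha he.symm).elim
  exact hne (eq_of_pattern hm hdm hstep hletter hmod)

end Closing

section Spheres

variable {K : ℕ} {A C : Type} {h : CRAlphabet K A} {P R r : ℕ} {v w : List A} {c e : ℕ → C}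
  {p i : ℕ}

theorem SameView.symm (hS : SameView h R v c p w e i) : SameView h R w e i v c p :=
  fun u hu => (hS u hu).symm

theorem SameView.exists_walk (hS : SameView h R v c p w e i) {u : List Dir} (hu : u.length ≤ R)
    {j : ℕ} (hj : walk h v u p = some j) :
    ∃ k, walk h w u i = some k ∧ label w e k = label v c j := by
  have := hS u hu
  rw [hj, Option.map_some, eq_comm, Option.map_eq_some_iff] at this
  exact this

theorem SameView.label_eq (hS : SameView h R v c p w e i) {u : List Dir} (hu : u.length ≤ R)
    {j k : ℕ} (hj : walk h v u p = some j) (hk : walk h w u i = some k) :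
    label v c j = label w e k := by
  have := hS u hu
  rw [hj, hk] at this
  exact Option.some.inj this

/-- Walks with the same end have the same end in every properly colored nested word that looks
alike. -/
theorem SameView.end_unique (hS : SameView h R v c p w e i) (hw : ProperColoring h P w e)
    {u u' : List Dir} (hu : u.length ≤ R) (hu' : u'.length ≤ R) (hP : u.length + u'.length ≤ P)
    {j k k' : ℕ} (hj : walk h v u p = some j) (hj' : walk h v u' p = some j)
    (hk : walk h w u i = some k) (hk' : walk h w u' i = some k') : k = k' := by
  have h1 := (hS.label_eq hu hj hk).symm.trans (hS.label_eq hu' hj' hk')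
  refine hw (backtrack u ++ u') k k' ?_ (walk_append_of_some (walk_backtrack hk) hk')
    (congrArg Prod.snd h1)
  simpa [length_backtrack] using hP

theorem SameView.stepRel (hS : SameView h R v c p w e i) (hw : ProperColoring h P w e)
    (hR : r + 1 ≤ R) (hP : 2 * r + 1 ≤ P) {u u' : List Dir} (hu : u.length ≤ r)
    (hu' : u'.length ≤ r) {d : Dir} {j k j' k' : ℕ}
    (hj : walk h v u p = some j) (hk : walk h v u' p = some k)
    (hj' : walk h w u i = some j') (hk' : walk h w u' i = some k')
    (hs : StepRel h v d j k) : StepRel h w d j' k' := by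
  have hl : (u ++ [d]).length = u.length + 1 := by simp
  have h1 : walk h v (u ++ [d]) p = some k := by rw [walk_concat hj, move_eq_some.2 hs]
  obtain ⟨k₂, h2, -⟩ := hS.exists_walk (by omega) h1
  obtain rfl := hS.end_unique hw (by omega) (by omega) (by omega) h1 hk h2 hk'
  rwa [walk_concat hj', move_eq_some] at h2

theorem SameView.matched (hS : SameView h R v c p w e i) (hw : ProperColoring h P w e)
    (hR : r + 1 ≤ R) (hP : 2 * r + 1 ≤ P) {u u' : List Dir} (hu : u.length ≤ r)
    (hu' : u'.length ≤ r) {s : Fin K} {j k j' k' : ℕ}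
    (hj : walk h v u p = some j) (hk : walk h v u' p = some k)
    (hj' : walk h w u i = some j') (hk' : walk h w u' i = some k')
    (hs : Matched h v s j k) : Matched h w s j' k' := by
  obtain ⟨t, ht⟩ : MuAny h w j' k' :=
    hS.stepRel (d := (true, true)) hw hR hP hu hu' hj hk hj' hk' ⟨s, hs⟩
  have h1 : v[j]? = w[j']? := congrArg Prod.fst (hS.label_eq (by omega) hj hj')
  have h2 := hs.kind_left
  rw [h1, ht.kind_left] at h2
  simp only [Option.some.injEq, CRKind.call.injEq] at h2
  exact h2 ▸ ht

/-- In properly colored nested words, positions that look alike have isomorphic spheres. -/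
theorem SameView.sphIso (hS : SameView h R v c p w e i) (hv : ProperColoring h P v c)
    (hw : ProperColoring h P w e) (hR : r + 1 ≤ R) (hP : 2 * r + 1 ≤ P)
    (hp : p < v.length) (hi : i < w.length) : SphIso h r v p w i := by
  have hex : ∀ j, ∃ k, ∀ u : List Dir, u.length ≤ r → walk h v u p = some j →
      walk h w u i = some k := by
    intro j
    by_cases hj : ∃ u : List Dir, u.length ≤ r ∧ walk h v u p = some j
    · obtain ⟨u, hu, hj⟩ := hj
      obtain ⟨k, hk, -⟩ := hS.exists_walk (by omega) hj
      refine ⟨k, fun u' hu' hj' => ?_⟩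
      obtain ⟨k', hk', -⟩ := hS.exists_walk (by omega) hj'
      rw [hk', hS.end_unique hw (by omega) (by omega) (by omega) hj hj' hk hk']
    · exact ⟨0, fun u hu hj' => (hj ⟨u, hu, hj'⟩).elim⟩
  choose f hf using hex
  have hball : ∀ j ∈ ball h v r p, ∃ u : List Dir, u.length ≤ r ∧ walk h v u p = some j ∧
      walk h w u i = some (f j) := by
    intro j hj
    obtain ⟨u, hu, hj⟩ := distLE_iff.1 hj
    exact ⟨u, hu, hj, hf j u hu hj⟩
  refine ⟨f, hp, hi, ?_, ⟨?_, ?_, ?_⟩, ?_, ?_⟩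
  · exact (Option.some.inj (hf p [] (by simp) rfl)).symm
  · intro j hj
    obtain ⟨u, hu, -, hk⟩ := hball j hj
    exact distLE_iff.2 ⟨u, hu, hk⟩
  · intro j hj j' hj' he
    obtain ⟨u, hu, hj, hk⟩ := hball j hj
    obtain ⟨u', hu', hj', hk'⟩ := hball j' hj'
    rw [← he] at hk'
    exact hS.symm.end_unique hv (by omega) (by omega) (by omega) hk hk' hj hj'
  · intro k hk
    obtain ⟨u, hu, hk⟩ := distLE_iff.1 hk
    obtain ⟨j, hj, -⟩ := hS.symm.exists_walk (by omega) hk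
    refine ⟨j, distLE_iff.2 ⟨u, hu, hj⟩, ?_⟩
    exact Option.some.inj ((hf j u hu hj).symm.trans hk)
  · intro j hj
    obtain ⟨u, hu, hj, hk⟩ := hball j hj
    exact congrArg Prod.fst (hS.label_eq (by omega) hj hk)
  · intro j hj k hk
    obtain ⟨u, hu, hj, hj'⟩ := hball j hj
    obtain ⟨u', hu', hk, hk'⟩ := hball k hk
    refine ⟨⟨?_, ?_⟩, fun s => ⟨?_, ?_⟩⟩
    · exact hS.stepRel (d := (false, true)) hw hR hP hu hu' hj hk hj' hk'
    · exact hS.symm.stepRel (d := (false, true)) hv hR hP hu hu' hj' hk' hj hk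
    · exact hS.matched hw hR hP hu hu' hj hk hj' hk'
    · exact hS.symm.matched hv hR hP hu hu' hj' hk' hj hk

end Spheres

/-- In a `2`-stack nested word, a coloring is proper if every position looks like a position of a
properly colored nested word. -/
theorem properColoring_of_sameView {A C : Type} {h : CRAlphabet 2 A} {P : ℕ} {w : List A}
    {e : ℕ → C} (H : ∀ i < w.length, ∃ v c p,
      ProperColoring h P v c ∧ SameView h (P + 1) v c p w e i) : ProperColoring h P w e := by
  refine properColoring_of_neighborhoods fun u i j hu hw he => ?_
  rcases eq_or_lt_of_walk hw with rfl | ⟨hi, -⟩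
  · exact ⟨rfl, fun _ => rfl⟩
  obtain ⟨v, c, p, hv, hS⟩ := H i hi
  obtain ⟨p', hp', hl⟩ := hS.symm.exists_walk (by omega) hw
  have h0 : label v c p = label w e i := hS.label_eq (u := []) (by simp) rfl rfl
  have hc : c p = c p' := by
    have h1 : c p = e i := congrArg Prod.snd h0
    have h2 : c p' = e j := congrArg Prod.snd hl
    rw [h1, h2, he]
  obtain rfl := hv u p p' hu hp' hc
  refine ⟨h0.symm.trans hl, fun d => ?_⟩
  have h1 := hS [d] (by simp)
  have h2 := hS (u ++ [d]) (by simpa using hu)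
  rw [walk_singleton, walk_singleton] at h1
  rw [walk_concat hp', walk_concat hw] at h2
  exact h1.symm.trans h2

section Automaton

variable {K : ℕ} {A C : Type}

/-- The state `q` is the view from the position `p` of a properly colored nested word. -/
def IsView (h : CRAlphabet K A) (P : ℕ)
    (q : {u : List Dir // u.length ≤ P + 1} → Option (Option A × C))
    (v : List A) (c : ℕ → C) (p : ℕ) : Prop :=
  ProperColoring h P v c ∧ p < v.length ∧ q = view h (P + 1) v c p

/-- The automaton guessing a proper coloring of a nested word together with the views from its
positions.  Its transitions are those occurring in properly colored nested words. -/
def sphereAutomaton (h : CRAlphabet K A) (C : Type) (P : ℕ) :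
    GMNWA K A ({u : List Dir // u.length ≤ P + 1} → Option (Option A × C)) where
  delta1 q a q' :=
    (q = (fun _ => none) ∧ ∃ v c, IsView h P q' v c 0 ∧ v[0]? = some a) ∨
    ∃ v c p, IsView h P q v c p ∧ IsView h P q' v c (p + 1) ∧ v[p + 1]? = some a ∧
      ¬ ∃ j, MuAny h v j (p + 1)
  delta2 qc q a q' := ∃ v c p k, IsView h P qc v c k ∧ IsView h P q v c p ∧
    IsView h P q' v c (p + 1) ∧ v[p + 1]? = some a ∧ MuAny h v k (p + 1)
  qI := {fun _ => none}
  qF := {q | ∃ v c, IsView h P q v c (v.length - 1)}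
  qC := {q | ∃ v c p j, IsView h P q v c p ∧ MuAny h v p j}

variable {h : CRAlphabet K A} {P : ℕ} {w : List A}
  {q q' : {u : List Dir // u.length ≤ P + 1} → Option (Option A × C)}

theorem IsView.ne_none {v : List A} {c : ℕ → C} {p : ℕ} (hq : IsView h P q v c p) :
    q ≠ fun _ => none := by
  rintro rfl
  have := congrFun hq.2.2 ⟨[], by simp⟩
  simp [view, walk] at this

/-- The views of a properly colored nested word form an accepting run. -/
theorem view_run (hw : w ≠ []) {c : ℕ → C} (hc : ProperColoring h P w c) :
    gRun h (sphereAutomaton h C P) w (view h (P + 1) w c) ∧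
      gAcc h (sphereAutomaton h C P) w (view h (P + 1) w c) := by
  have hlen : 0 < w.length := List.length_pos_iff.2 hw
  have hview : ∀ i < w.length, IsView h P (view h (P + 1) w c i) w c i := fun i hi => ⟨hc, hi, rfl⟩
  refine ⟨⟨⟨_, rfl, w[0], List.getElem?_eq_getElem hlen,
    .inl ⟨rfl, w, c, hview 0 hlen, List.getElem?_eq_getElem hlen⟩⟩, ?_⟩, ?_, ?_⟩
  · intro i h0 hi
    obtain ⟨k, rfl⟩ : ∃ k, i = k + 1 := ⟨i - 1, by omega⟩
    refine ⟨w[k + 1], List.getElem?_eq_getElem hi, ?_⟩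
    by_cases hm : ∃ j, MuAny h w j (k + 1)
    · obtain ⟨j, hj⟩ := hm
      exact .inl ⟨j, hj, w, c, k, j, hview j (hj.lt.trans hi), hview k (by omega), hview _ hi,
        List.getElem?_eq_getElem hi, hj⟩
    · exact .inr ⟨hm, .inr ⟨w, c, k, hview k (by omega), hview _ hi,
        List.getElem?_eq_getElem hi, hm⟩⟩
  · exact ⟨w, c, hview _ (by omega)⟩
  · rintro i - ⟨v, c', p, j, ⟨-, -, he⟩, hj⟩
    have h1 := congrFun he ⟨[(true, true)], by simp⟩
    have h2 : StepRel h v (true, true) p j := hj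
    simp only [view, walk_singleton, move_eq_some.2 h2, Option.map_some,
      Option.map_eq_some_iff] at h1
    obtain ⟨k, hk, -⟩ := h1
    exact ⟨k, move_eq_some.1 hk⟩

section Runs

variable {ρ : ℕ → {u : List Dir // u.length ≤ P + 1} → Option (Option A × C)}

theorem gRun.start (hρ : gRun h (sphereAutomaton h C P) w ρ) :
    ∃ v c, IsView h P (ρ 0) v c 0 ∧ v[0]? = w[0]? := by
  obtain ⟨⟨q, rfl, a, ha, ⟨-, v, c, h1, h2⟩ | ⟨v, c, p, h1, -⟩⟩, -⟩ := hρ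
  · exact ⟨v, c, h1, h2.trans ha.symm⟩
  · exact (h1.ne_none rfl).elim

theorem gRun.isView (hρ : gRun h (sphereAutomaton h C P) w ρ) {i : ℕ} (hi : i < w.length) :
    ∃ v c p, IsView h P (ρ i) v c p ∧ v[p]? = w[i]? := by
  rcases Nat.eq_zero_or_pos i with rfl | h0
  · obtain ⟨v, c, h1, h2⟩ := hρ.start
    exact ⟨v, c, 0, h1, h2⟩
  · obtain ⟨a, ha, ⟨j, -, v, c, p, k, -, -, h1, h2, -⟩ | ⟨-, ⟨-, v, c, h1, h2⟩ |
      ⟨v, c, p, -, h1, h2, -⟩⟩⟩ := hρ.2 i h0 hi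
    exacts [⟨v, c, _, h1, h2.trans ha.symm⟩, ⟨v, c, _, h1, h2.trans ha.symm⟩,
      ⟨v, c, _, h1, h2.trans ha.symm⟩]

theorem gRun.succ (hρ : gRun h (sphereAutomaton h C P) w ρ) {i : ℕ} (hi : i + 1 < w.length) :
    ∃ v c p, IsView h P (ρ i) v c p ∧ IsView h P (ρ (i + 1)) v c (p + 1) ∧
      ((∃ j k, MuAny h w j (i + 1) ∧ IsView h P (ρ j) v c k ∧ MuAny h v k (p + 1)) ∨
        ((¬ ∃ j, MuAny h w j (i + 1)) ∧ ¬ ∃ j, MuAny h v j (p + 1))) := by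
  obtain ⟨a, -, ⟨j, hj, v, c, p, k, h1, h2, h3, -, h4⟩ | ⟨hj, ⟨h0, -⟩ |
      ⟨v, c, p, h1, h2, -, h3⟩⟩⟩ := hρ.2 (i + 1) (by omega) hi
  · exact ⟨v, c, p, h2, h3, .inl ⟨j, k, hj, h1, h4⟩⟩
  · obtain ⟨v, c, p, h1, -⟩ := hρ.isView (show i < w.length by omega)
    exact (h1.ne_none h0).elim
  · exact ⟨v, c, p, h1, h2, .inr ⟨hj, h3⟩⟩

theorem gRun.stepRel (hρ : gRun h (sphereAutomaton h C P) w ρ) {d : Dir} {i j : ℕ}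
    (hs : StepRel h w d i j) :
    ∃ v c p p', IsView h P (ρ i) v c p ∧ IsView h P (ρ j) v c p' ∧ StepRel h v d p p' := by
  have hmu : ∀ i j, MuAny h w i j →
      ∃ v c p p', IsView h P (ρ i) v c p ∧ IsView h P (ρ j) v c p' ∧ MuAny h v p p' := by
    intro i j hm
    obtain ⟨j, rfl⟩ : ∃ k, j = k + 1 := ⟨j - 1, by have := hm.lt; omega⟩
    obtain ⟨v, c, p, -, h2, ⟨i', k, hm', h3, h4⟩ | ⟨hn, -⟩⟩ := hρ.succ hm.lt_length
    · obtain rfl := hm.left_unique hm'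
      exact ⟨v, c, k, p + 1, h3, h2, h4⟩
    · exact (hn ⟨i, hm⟩).elim
  obtain ⟨_ | _, _ | _⟩ := d
  · obtain ⟨rfl, hl⟩ := hs
    obtain ⟨v, c, p, h1, h2, -⟩ := hρ.succ hl
    exact ⟨v, c, p + 1, p, h2, h1, rfl, h2.2.1⟩
  · obtain ⟨rfl, hl⟩ := hs
    obtain ⟨v, c, p, h1, h2, -⟩ := hρ.succ hl
    exact ⟨v, c, p, p + 1, h1, h2, rfl, h2.2.1⟩
  · obtain ⟨v, c, p, p', h1, h2, h3⟩ := hmu j i hs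
    exact ⟨v, c, p', p, h2, h1, h3⟩
  · exact hmu i j hs

theorem gRun.not_stepRel (hρ : gRun h (sphereAutomaton h C P) w ρ)
    (hacc : gAcc h (sphereAutomaton h C P) w ρ) {d : Dir} {i : ℕ} (hi : i < w.length)
    (hn : ∀ j, ¬ StepRel h w d i j) :
    ∃ v c p, IsView h P (ρ i) v c p ∧ ∀ j, ¬ StepRel h v d p j := by
  obtain ⟨_ | _, _ | _⟩ := d
  · obtain rfl : i = 0 := by
      by_contra h0
      exact hn (i - 1) ⟨by omega, hi⟩
    obtain ⟨v, c, h1, -⟩ := hρ.start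
    exact ⟨v, c, 0, h1, fun j hj => absurd hj.1 (by omega)⟩
  · obtain rfl : i = w.length - 1 := by
      by_contra h0
      exact hn (i + 1) ⟨rfl, by omega⟩
    obtain ⟨v, c, h1⟩ := hacc.1
    refine ⟨v, c, _, h1, fun j hj => ?_⟩
    have := hj.1
    have := hj.2
    omega
  · rcases i with _ | i
    · obtain ⟨v, c, h1, -⟩ := hρ.start
      exact ⟨v, c, 0, h1, fun j hj => Nat.not_lt_zero _ (MuAny.lt hj)⟩
    · obtain ⟨v, c, p, -, h2, ⟨j, _, hj, -⟩ | ⟨-, h3⟩⟩ := hρ.succ hi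
      · exact (hn j hj).elim
      · exact ⟨v, c, p + 1, h2, fun j hj => h3 ⟨j, hj⟩⟩
  · obtain ⟨v, c, p, h1, -⟩ := hρ.isView hi
    refine ⟨v, c, p, h1, fun j hj => ?_⟩
    obtain ⟨k, hk⟩ := hacc.2 i hi ⟨v, c, p, j, h1, hj⟩
    exact hn k hk

/-- The states of an accepting run are the views of a coloring of the nested word. -/
theorem gRun.exists_coloring [Inhabited C] (hρ : gRun h (sphereAutomaton h C P) w ρ)
    (hacc : gAcc h (sphereAutomaton h C P) w ρ) :
    ∃ e : ℕ → C, ∀ i < w.length, ρ i = view h (P + 1) w e i := by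
  refine ⟨fun i => ((ρ i ⟨[], by simp⟩).map Prod.snd).getD default, fun i hi => ?_⟩
  funext ⟨u, hu⟩
  induction u generalizing i with
  | nil =>
    obtain ⟨v, c, p, ⟨-, -, h1⟩, h2⟩ := hρ.isView hi
    simp [h1, view, walk, label, h2]
  | cons d u ih =>
    by_cases hs : ∃ j, StepRel h w d i j
    · obtain ⟨j, hj⟩ := hs
      obtain ⟨v, c, p, p', ⟨-, -, h1⟩, ⟨-, -, h2⟩, h3⟩ := hρ.stepRel hj
      have h4 := ih j hj.lt_length.2 (Nat.le_of_succ_le hu)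
      rw [h2] at h4
      rw [h1]
      simp only [view, walk, move_eq_some.2 h3, move_eq_some.2 hj, Option.bind_some] at h4 ⊢
      exact h4
    · push Not at hs
      obtain ⟨v, c, p, ⟨-, -, h1⟩, h2⟩ := hρ.not_stepRel hacc hi hs
      rw [h1]
      simp only [view, walk, move_eq_none.2 h2, move_eq_none.2 hs, Option.bind_none]
      rfl

end Runs

end Automaton

/-- sphere automaton correctness.  For every radius `r` there
are a (finite) generalized 2-stack nested-word automaton `B` and a map `η`
assigning to every state a pointed nested word (representing an `r`-sphere)
such that `B` accepts every nested word, and in every accepting run `ρ` on a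
nested word `w`, for every position `i`, `η(ρ(i))` is isomorphic (as a
pointed `r`-sphere) to the `r`-sphere of `w` around `i`. -/
theorem stmt14 (A : Type) [Fintype A] (h : CRAlphabet 2 A) (r : ℕ) :
    ∃ (Q : Type) (_ : Fintype Q) (B : GMNWA 2 A Q) (η : Q → List A × ℕ),
      gLang h B = {w | w ≠ []} ∧
      ∀ w ρ, w ≠ [] → gRun h B w ρ → gAcc h B w ρ →
        ∀ i < w.length, SphIso h r (η (ρ i)).1 (η (ρ i)).2 w i := by
  classical
  obtain ⟨M, hM, hcol⟩ := exists_properColoring h (2 * r + 1)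
  have : Finite {u : List Dir // u.length ≤ 2 * r + 1 + 1} :=
    (List.finite_length_le Dir _).to_subtype
  have : Inhabited (Fin M) := ⟨⟨0, hM⟩⟩
  have hη : ∀ q : {u : List Dir // u.length ≤ 2 * r + 1 + 1} → Option (Option A × Fin M),
      ∃ x : List A × ℕ, (∃ v c p, IsView h (2 * r + 1) q v c p) →
        ∃ c, IsView h (2 * r + 1) q x.1 c x.2 := by
    intro q
    by_cases hq : ∃ v c p, IsView h (2 * r + 1) q v c p
    · obtain ⟨v, c, p, hq⟩ := hq
      exact ⟨(v, p), fun _ => ⟨c, hq⟩⟩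
    · exact ⟨([], 0), fun h' => (hq h').elim⟩
  choose η hη using hη
  refine ⟨_, Fintype.ofFinite _, sphereAutomaton h (Fin M) (2 * r + 1), η, ?_, ?_⟩
  · refine Set.Subset.antisymm (fun w hw => hw.1) fun w hw => ?_
    obtain ⟨c, hc⟩ := hcol w
    exact ⟨hw, _, view_run hw hc⟩
  · intro w ρ _ hρ hacc i hi
    obtain ⟨e, he⟩ := hρ.exists_coloring hacc
    have hsame : ∀ i < w.length, ∀ v c p, IsView h (2 * r + 1) (ρ i) v c p →
        SameView h (2 * r + 1 + 1) v c p w e i := fun i hi v c p hq u hu =>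
      congrFun (hq.2.2.symm.trans (he i hi)) ⟨u, hu⟩
    have hproper : ProperColoring h (2 * r + 1) w e := by
      refine properColoring_of_sameView fun i hi => ?_
      obtain ⟨v, c, p, hq, -⟩ := hρ.isView hi
      exact ⟨v, c, p, hq.1, hsame i hi v c p hq⟩
    obtain ⟨v, c, p, hq, -⟩ := hρ.isView hi
    obtain ⟨c', hq'⟩ := hη (ρ i) ⟨v, c, p, hq⟩
    exact (hsame i hi _ c' _ hq').sphIso hq'.1 hproper (by omega) le_rfl hq'.2.1 hi
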